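/- arXiv:2003.12429 — 3 statements merged into one kernel-verified Lean document; each statement's English description precedes it below -/
import Mathlib

section
/- Let q be a prime power, F a finite field with q elements, 1 ≤ k ≤ n−1. If 𝓛 is a Cameron–Liebler k-set of AG(n,q), then 𝓛′ := 𝓛 ∪ {projective k-spaces K : K ≤ H∞} is a Cameron–Liebler k-set of PG(n,q) with |𝓛′| = |𝓛| + [n k+1]_q; in particular, if 𝓛 has parameter x then 𝓛′ has parameter x + (q^{n−k} − 1)/(q^{k+1} − 1). -/
open Module

/-- The Gaussian binomial coefficient `[a b]_q`. -/
noncomputable def gaussBinom (q a b : ℕ) : ℚ :=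
  ∏ i ∈ Finset.range b, ((q : ℚ) ^ (a - i) - 1) / ((q : ℚ) ^ (i + 1) - 1)

variable {F : Type} [Field F] [Fintype F] {n : ℕ}

/-- `K` is a projective `j`-space of `PG(n,q)`: a submodule of rank `j+1`. -/
def IsProjSub (j : ℕ) (K : Submodule F (Fin (n + 1) → F)) : Prop :=
  Module.finrank F K = j + 1

/-- `P` is a projective point: a submodule of rank `1`. -/
def IsProjPoint (P : Submodule F (Fin (n + 1) → F)) : Prop :=
  Module.finrank F P = 1

/-- `P` is an affine point w.r.t. the hyperplane at infinity `Hinf`. -/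
def IsAffPoint (Hinf P : Submodule F (Fin (n + 1) → F)) : Prop :=
  Module.finrank F P = 1 ∧ ¬ P ≤ Hinf

/-- `K` is an affine `j`-space (a `j`-space of `AG(n,q)`). -/
def IsAffSub (j : ℕ) (Hinf K : Submodule F (Fin (n + 1) → F)) : Prop :=
  Module.finrank F K = j + 1 ∧ ¬ K ≤ Hinf

/-- `M` is a Cameron–Liebler `k`-set of `PG(n,q)`. -/
def IsCLProj (k : ℕ) (M : Set (Submodule F (Fin (n + 1) → F))) : Prop :=
  (∀ K ∈ M, IsProjSub k K) ∧
  ∃ w : Submodule F (Fin (n + 1) → F) → ℝ,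
    ∀ K, IsProjSub k K →
      Set.indicator M (fun _ => (1 : ℝ)) K =
        ∑ᶠ P ∈ {P | IsProjPoint P ∧ P ≤ K}, w P

/-- `L` is a Cameron–Liebler `k`-set of `AG(n,q)`. -/
def IsCLAff (k : ℕ) (Hinf : Submodule F (Fin (n + 1) → F))
    (L : Set (Submodule F (Fin (n + 1) → F))) : Prop :=
  (∀ K ∈ L, IsAffSub k Hinf K) ∧
  ∃ w : Submodule F (Fin (n + 1) → F) → ℝ,
    ∀ K, IsAffSub k Hinf K →
      Set.indicator L (fun _ => (1 : ℝ)) K =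
        ∑ᶠ P ∈ {P | IsAffPoint Hinf P ∧ P ≤ K}, w P

/-- `S` is a `k`-spread of `AG(n,q)`: every affine point is on exactly one member. -/
def IsSpread (k : ℕ) (Hinf : Submodule F (Fin (n + 1) → F))
    (S : Set (Submodule F (Fin (n + 1) → F))) : Prop :=
  (∀ K ∈ S, IsAffSub k Hinf K) ∧
  ∀ P, IsAffPoint Hinf P → ∃! K, K ∈ S ∧ P ≤ K


/-- A linearly independent `j`-tuple amounts to its `j`-dimensional span together with a linearly
independent `j`-tuple in this span. -/
noncomputable def linearIndependentEquivSigma (K V : Type*) [DivisionRing K] [AddCommGroup V]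
    [Module K V] [FiniteDimensional K V] (j : ℕ) :
    {s : Fin j → V // LinearIndependent K s} ≃
      Σ U : {U : Submodule K V // finrank K U = j}, {s : Fin j → U.1 // LinearIndependent K s} where
  toFun s := ⟨⟨Submodule.span K (Set.range s.1), by simp [finrank_span_eq_card s.2]⟩,
    ⟨_, linearIndependent_span s.2⟩⟩
  invFun p := ⟨fun i => (p.2.1 i : V), p.2.2.map' p.1.1.subtype p.1.1.ker_subtype⟩
  left_inv s := rfl
  right_inv := by
    rintro ⟨⟨U, hU⟩, ⟨s, hs⟩⟩
    have hli : LinearIndependent K (fun i => (s i : V)) := hs.map' U.subtype U.ker_subtype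
    have hspan : Submodule.span K (Set.range fun i => (s i : V)) = U := by
      apply Submodule.eq_of_le_of_finrank_eq
      · rw [Submodule.span_le]
        rintro _ ⟨i, rfl⟩
        exact (s i).2
      · rw [finrank_span_eq_card hli, hU, Fintype.card_fin]
    have hext (U' : Submodule K V) (h : U' = U) (hU' : finrank K U' = j) (s' : Fin j → U')
        (hs' : LinearIndependent K s') (hss' : ∀ i, (s' i : V) = s i) :
        (⟨⟨U', hU'⟩, ⟨s', hs'⟩⟩ : Σ U : {U : Submodule K V // finrank K U = j},
          {s : Fin j → U.1 // LinearIndependent K s}) = ⟨⟨U, hU⟩, ⟨s, hs⟩⟩ := by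
      subst h
      obtain rfl : s' = s := funext fun i => Subtype.ext (hss' i)
      rfl
    exact hext _ hspan _ _ _ fun _ => rfl

/-- The number of `j`-dimensional subspaces of a `d`-dimensional space over a field with `q`
elements, times the number of bases of each, is the number of independent `j`-tuples. -/
theorem card_finrank_eq_mul_prod {K V : Type*} [Field K] [Fintype K] [AddCommGroup V] [Module K V]
    [Finite V] {j : ℕ} (hj : j ≤ finrank K V) :
    Nat.card {U : Submodule K V // finrank K U = j} *
        ∏ i : Fin j, (Fintype.card K ^ j - Fintype.card K ^ i.val) =
      ∏ i : Fin j, (Fintype.card K ^ finrank K V - Fintype.card K ^ i.val) := by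
  have : Fintype {U : Submodule K V // finrank K U = j} := Fintype.ofFinite _
  have hU (U : {U : Submodule K V // finrank K U = j}) :
      Nat.card {s : Fin j → U.1 // LinearIndependent K s} =
        ∏ i : Fin j, (Fintype.card K ^ j - Fintype.card K ^ i.val) := by
    simpa [U.2] using card_linearIndependent (K := K) (V := U.1) (k := j) U.2.ge
  rw [← card_linearIndependent hj, Nat.card_congr (linearIndependentEquivSigma K V j),
    Nat.card_sigma, Finset.sum_congr rfl fun U _ => hU U]
  simp

theorem ncard_finrank_eq_mul_prod {K V : Type*} [Field K] [Fintype K] [AddCommGroup V] [Module K V]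
    [Finite V] (W : Submodule K V) {j : ℕ} (hj : j ≤ finrank K W) :
    {U : Submodule K V | finrank K U = j ∧ U ≤ W}.ncard *
        ∏ i : Fin j, (Fintype.card K ^ j - Fintype.card K ^ i.val) =
      ∏ i : Fin j, (Fintype.card K ^ finrank K W - Fintype.card K ^ i.val) := by
  rw [← card_finrank_eq_mul_prod hj]
  congr 1
  let f (U : {U : Submodule K W // finrank K U = j}) :
      {U : Submodule K V | finrank K U = j ∧ U ≤ W} :=
    ⟨U.1.map W.subtype, (Submodule.finrank_map_subtype_eq W U.1).trans U.2,
      Submodule.map_subtype_le W U.1⟩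
  refine (Nat.card_congr (Equiv.ofBijective f ⟨?_, ?_⟩)).symm
  · rintro ⟨U, _⟩ ⟨U', _⟩ h
    simpa using Submodule.map_injective_of_injective W.injective_subtype (congrArg Subtype.val h)
  · rintro ⟨U, hU, hUW⟩
    have hmap : (U.comap W.subtype).map W.subtype = U := by
      rw [Submodule.map_comap_subtype, inf_eq_right.2 hUW]
    exact ⟨⟨U.comap W.subtype, by rw [← Submodule.finrank_map_subtype_eq, hmap, hU]⟩,
      Subtype.ext hmap⟩

/-- The number of `b`-dimensional subspaces of an `a`-dimensional space is `[a b]_q`. -/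
theorem ncard_finrank_eq_gaussBinom {K V : Type*} [Field K] [Fintype K] [AddCommGroup V]
    [Module K V] [Finite V] (W : Submodule K V) {b : ℕ} (hb : b ≤ finrank K W) :
    ({U : Submodule K V | finrank K U = b ∧ U ≤ W}.ncard : ℚ) =
      gaussBinom (Fintype.card K) (finrank K W) b := by
  have hq : 1 < Fintype.card K := Fintype.one_lt_card
  have hprod (d : ℕ) (hd : b ≤ d) :
      ((∏ i : Fin b, (Fintype.card K ^ d - Fintype.card K ^ i.val) : ℕ) : ℚ) =
        (∏ i ∈ Finset.range b, (Fintype.card K : ℚ) ^ i) *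
          ∏ i ∈ Finset.range b, ((Fintype.card K : ℚ) ^ (d - i) - 1) := by
    rw [Fin.prod_univ_eq_prod_range (fun i => Fintype.card K ^ d - Fintype.card K ^ i),
      ← Finset.prod_mul_distrib, Nat.cast_prod]
    refine Finset.prod_congr rfl fun i hi => ?_
    have hid : i ≤ d := (Finset.mem_range.1 hi).le.trans hd
    rw [Nat.cast_sub (Nat.pow_le_pow_right hq.le hid), mul_sub, ← pow_add,
      Nat.add_sub_cancel' hid]
    simp
  have hreflect : ∏ i ∈ Finset.range b, ((Fintype.card K : ℚ) ^ (b - i) - 1) =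
      ∏ i ∈ Finset.range b, ((Fintype.card K : ℚ) ^ (i + 1) - 1) := by
    rw [← Finset.prod_range_reflect]
    refine Finset.prod_congr rfl fun i hi => ?_
    have := Finset.mem_range.1 hi
    congr 2
    omega
  have hne : ∏ i ∈ Finset.range b, ((Fintype.card K : ℚ) ^ (i + 1) - 1) ≠ 0 :=
    Finset.prod_ne_zero_iff.2 fun i _ =>
      (sub_pos.2 (one_lt_pow₀ (by exact_mod_cast hq) i.succ_ne_zero)).ne'
  have hpow : ∏ i ∈ Finset.range b, (Fintype.card K : ℚ) ^ i ≠ 0 :=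
    Finset.prod_ne_zero_iff.2 fun i _ => pow_ne_zero _ (by positivity)
  have h := congrArg (Nat.cast (R := ℚ)) (ncard_finrank_eq_mul_prod W hb)
  rw [Nat.cast_mul, hprod b le_rfl, hprod _ hb, hreflect, mul_left_comm] at h
  rw [gaussBinom, Finset.prod_div_distrib, eq_div_iff hne]
  exact mul_left_cancel₀ hpow h

theorem ncard_points_mul {K V : Type*} [Field K] [Fintype K] [AddCommGroup V] [Module K V]
    [Finite V] (W : Submodule K V) (hW : 1 ≤ finrank K W) :
    {P : Submodule K V | finrank K P = 1 ∧ P ≤ W}.ncard * (Fintype.card K - 1) =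
      Fintype.card K ^ finrank K W - 1 := by
  simpa using ncard_finrank_eq_mul_prod W hW

theorem finrank_inf_hyperplane {R : Type} [Field R] {n k : ℕ} {H K : Submodule R (Fin (n + 1) → R)}
    (hH : finrank R H = n) (hK : IsAffSub k H K) :
    finrank R (K ⊓ H : Submodule R _) = k := by
  have hlt : H < K ⊔ H := right_lt_sup.2 hK.2
  have hsup := Submodule.finrank_lt_finrank_of_lt hlt
  have hle := Submodule.finrank_le (K ⊔ H)
  have hadd := Submodule.finrank_sup_add_finrank_inf_eq K H
  rw [finrank_fin_fun] at hle
  have := hK.1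
  omega

/-- Adjoining all `k`-spaces at infinity to a Cameron–Liebler `k`-set of `AG(n,q)` gives a
Cameron–Liebler `k`-set of `PG(n,q)`. -/
theorem IsCLAff.union_infinity {k : ℕ} (hk : 1 ≤ k) {H : Submodule F (Fin (n + 1) → F)}
    (hH : finrank F H = n) {L : Set (Submodule F (Fin (n + 1) → F))} (hL : IsCLAff k H L) :
    IsCLProj k (L ∪ {K | IsProjSub k K ∧ K ≤ H}) := by
  classical
  obtain ⟨hLsub, w, hw⟩ := hL
  refine ⟨fun K hK => hK.elim (fun h => (hLsub K h).1) (fun h => h.1), ?_⟩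
  set q := Fintype.card F
  have hq1 : (1 : ℝ) < q := by exact_mod_cast Fintype.one_lt_card (α := F)
  have hpts (W : Submodule F (Fin (n + 1) → F)) (hW : 1 ≤ finrank F W) :
      ({P | IsProjPoint P ∧ P ≤ W}.ncard : ℝ) = ((q : ℝ) ^ finrank F W - 1) / (q - 1) := by
    rw [eq_div_iff (by linarith)]
    have h := congrArg (Nat.cast (R := ℝ)) (ncard_points_mul W hW)
    rw [Nat.cast_mul, Nat.cast_sub Fintype.card_pos, Nat.cast_sub (Nat.one_le_pow _ _
      Fintype.card_pos)] at h
    simpa [IsProjPoint] using h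
  have hsum (s : Set (Submodule F (Fin (n + 1) → F))) (c : ℝ) : ∑ᶠ P ∈ s, c = s.ncard * c := by
    rw [finsum_mem_eq_finite_toFinset_sum _ s.toFinite, Finset.sum_const,
      ← Set.ncard_eq_toFinset_card, nsmul_eq_mul]
  have hqk : (1 : ℝ) < q ^ k := one_lt_pow₀ hq1 (by omega)
  have hqk1 : (1 : ℝ) < q ^ (k + 1) := one_lt_pow₀ hq1 (by omega)
  have hq0 : (q : ℝ) ≠ 0 := by positivity
  have hq2 : (q : ℝ) - 1 ≠ 0 := by linarith
  have hqk2 : (q : ℝ) ^ (k + 1) - 1 ≠ 0 := by linarith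
  refine ⟨fun P => if P ≤ H then (q - 1) / ((q : ℝ) ^ (k + 1) - 1) else
    w P - ((q : ℝ) ^ k - 1) / (q ^ k * (q ^ (k + 1) - 1)), fun K hK => ?_⟩
  by_cases hKH : K ≤ H
  · rw [Set.indicator_of_mem (show K ∈ L ∪ {K | IsProjSub k K ∧ K ≤ H} from Or.inr ⟨hK, hKH⟩),
      finsum_mem_congr (g := fun _ => (q - 1) / ((q : ℝ) ^ (k + 1) - 1)) rfl
      fun P hP => if_pos (hP.2.trans hKH), hsum, hpts K (by rw [hK]; omega), hK]
    field_simp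
  · have haff : IsAffSub k H K := ⟨hK, hKH⟩
    have hsplit : {P | IsProjPoint P ∧ P ≤ K} =
        {P | IsAffPoint H P ∧ P ≤ K} ∪ {P | IsProjPoint P ∧ P ≤ K ⊓ H} := by
      ext P
      simp only [IsAffPoint, IsProjPoint, Set.mem_union, Set.mem_ofPred_eq, le_inf_iff]
      tauto
    have hdisj : Disjoint {P | IsAffPoint H P ∧ P ≤ K} {P | IsProjPoint P ∧ P ≤ K ⊓ H} :=
      Set.disjoint_left.2 fun P hP hP' => hP.1.2 (hP'.2.trans inf_le_right)
    have hinf : finrank F (K ⊓ H : Submodule F _) = k := finrank_inf_hyperplane hH haff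
    have hcard := Set.ncard_union_eq hdisj
    rw [← hsplit] at hcard
    replace hcard := congrArg (Nat.cast (R := ℝ)) hcard
    have hcardinf := hpts (K ⊓ H) (by omega)
    rw [hinf] at hcardinf
    rw [Nat.cast_add, hpts K (by rw [hK]; omega), hcardinf, hK] at hcard
    have hcardaff : ({P | IsAffPoint H P ∧ P ≤ K}.ncard : ℝ) = q ^ k := by
      rw [← sub_eq_iff_eq_add] at hcard
      rw [← hcard]
      field_simp
      ring
    have hind : (L ∪ {K | IsProjSub k K ∧ K ≤ H}).indicator (fun _ => (1 : ℝ)) K =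
        L.indicator (fun _ => (1 : ℝ)) K := by
      simp [Set.indicator, hKH]
    rw [hind, hw K haff, hsplit, finsum_mem_union hdisj (Set.toFinite _) (Set.toFinite _),
      finsum_mem_congr (g := fun P => w P - ((q : ℝ) ^ k - 1) / (q ^ k * (q ^ (k + 1) - 1))) rfl
        fun P hP => if_neg hP.1.2,
      finsum_mem_congr (g := fun _ => (q - 1) / ((q : ℝ) ^ (k + 1) - 1))
        (s := {P | IsProjPoint P ∧ P ≤ K ⊓ H}) rfl fun P hP => if_pos (hP.2.trans inf_le_right),
      finsum_mem_sub_distrib _ _ (Set.toFinite _), hsum, hsum, hcardaff, hcardinf]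
    field_simp
    ring

theorem statement6 (q k : ℕ) (hq : IsPrimePow q) (hF : Fintype.card F = q)
    (hk : 1 ≤ k) (hkn : k ≤ n - 1)
    (Hinf : Submodule F (Fin (n + 1) → F)) (hH : Module.finrank F Hinf = n)
    (L : Set (Submodule F (Fin (n + 1) → F)))
    (hL : IsCLAff k Hinf L) :
    IsCLProj k (L ∪ {K | IsProjSub k K ∧ K ≤ Hinf}) ∧
    ((L ∪ {K | IsProjSub k K ∧ K ≤ Hinf}).ncard : ℚ)
      = (L.ncard : ℚ) + gaussBinom q n (k + 1) := by
  refine ⟨hL.union_infinity hk hH, ?_⟩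
  have hdisj : Disjoint L {K | IsProjSub k K ∧ K ≤ Hinf} :=
    Set.disjoint_left.2 fun K hK hK' => (hL.1 K hK).2 hK'.2
  have hcard : ({K | IsProjSub k K ∧ K ≤ Hinf}.ncard : ℚ) = gaussBinom q n (k + 1) := by
    have h := ncard_finrank_eq_gaussBinom Hinf (b := k + 1) (by omega)
    rwa [hF, hH] at h
  rw [Set.ncard_union_eq hdisj, Nat.cast_add, hcard]
end

section
/- Let q be a prime power, F a finite field with q elements, k ≥ 1 and n ≥ 2k+1. If 𝓛 is a Cameron–Liebler k-set of AG(n,q) with |𝓛| = [n k]_q (parameter x = 1), then there exists an affine point P such that 𝓛 = {affine k-spaces K : P ≤ K}, the set of all affine k-spaces through P. -/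
open Module

variable {F : Type} [Field F] [Fintype F] {n : ℕ}

section Counting

variable {K W : Type*} [Field K] [AddCommGroup W] [Module K W]

theorem exists_le_finrank_eq [FiniteDimensional K W] {E : Submodule K W} {k : ℕ}
    (hk : k ≤ finrank K E) : ∃ D ≤ E, finrank K D = k := by
  obtain ⟨f, hf⟩ := exists_linearIndependent_of_le_finrank hk
  refine ⟨(Submodule.span K (Set.range f)).map E.subtype, Submodule.map_subtype_le _ _, ?_⟩
  rw [Submodule.finrank_map_subtype_eq, finrank_span_eq_card hf, Fintype.card_fin]

/-- Linearly independent families spanning a given subspace `D`, as families in `D`. -/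
noncomputable def linearIndependentSpanEquiv [FiniteDimensional K W] {k : ℕ} (D : Submodule K W)
    (hD : finrank K D = k) :
    {s : {s : Fin k → W // LinearIndependent K s} // Submodule.span K (Set.range s.1) = D} ≃
      {t : Fin k → D // LinearIndependent K t} where
  toFun s := ⟨fun i => ⟨s.1.1 i, s.2.le (Submodule.subset_span ⟨i, rfl⟩)⟩,
    LinearIndependent.of_comp D.subtype s.1.2⟩
  invFun t := ⟨⟨fun i => t.1 i, t.2.map' D.subtype D.ker_subtype⟩, by
    refine Submodule.eq_of_le_of_finrank_eq (Submodule.span_le.2 ?_) ?_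
    · rintro _ ⟨i, rfl⟩
      exact (t.1 i).2
    · exact (finrank_span_eq_card (t.2.map' D.subtype D.ker_subtype)).trans
        ((Fintype.card_fin k).trans hD.symm)⟩
  left_inv _ := rfl
  right_inv _ := rfl

variable [Fintype K]

theorem card_subspaces_mul [Finite W] {k : ℕ} (hk : k ≤ finrank K W) :
    Nat.card {D : Submodule K W // finrank K D = k} *
        ∏ i : Fin k, (Fintype.card K ^ k - Fintype.card K ^ i.val) =
      ∏ i : Fin k, (Fintype.card K ^ finrank K W - Fintype.card K ^ i.val) := by
  classical
  let f : {s : Fin k → W // LinearIndependent K s} → {D : Submodule K W // finrank K D = k} :=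
    fun s => ⟨Submodule.span K (Set.range s.1), by
      rw [finrank_span_eq_card s.2, Fintype.card_fin]⟩
  have := Fintype.ofFinite {D : Submodule K W // finrank K D = k}
  rw [← card_linearIndependent hk, ← Nat.card_congr (Equiv.sigmaFiberEquiv f), Nat.card_sigma]
  have hfib : ∀ D, Nat.card {s // f s = D} =
      ∏ i : Fin k, (Fintype.card K ^ k - Fintype.card K ^ i.val) := by
    rintro ⟨D, hD⟩
    rw [Nat.card_congr ((Equiv.subtypeEquivRight fun s => Subtype.ext_iff).trans
      (linearIndependentSpanEquiv D hD)), card_linearIndependent hD.ge, hD]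
  simp [hfib, Nat.card_eq_fintype_card]

theorem prod_pow_sub_pow (q : ℚ) {m k : ℕ} (hk : k ≤ m) :
    ∏ i ∈ Finset.range k, (q ^ m - q ^ i) =
      (∏ i ∈ Finset.range k, q ^ i) * ∏ i ∈ Finset.range k, (q ^ (m - i) - 1) := by
  rw [← Finset.prod_mul_distrib]
  refine Finset.prod_congr rfl fun i hi => ?_
  rw [mul_sub, mul_one, ← pow_add, Nat.add_sub_cancel' ((Finset.mem_range.1 hi).le.trans hk)]

theorem card_subspaces_eq_gaussBinom [Finite W] {k : ℕ} (hk : k ≤ finrank K W) :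
    (Nat.card {D : Submodule K W // finrank K D = k} : ℚ) =
      gaussBinom (Fintype.card K) (finrank K W) k := by
  have hq : (1 : ℚ) < Fintype.card K := by exact_mod_cast Fintype.one_lt_card
  have cast_prod : ∀ m, k ≤ m →
      ((∏ i : Fin k, (Fintype.card K ^ m - Fintype.card K ^ i.val) : ℕ) : ℚ) =
        ∏ i ∈ Finset.range k, ((Fintype.card K : ℚ) ^ m - (Fintype.card K : ℚ) ^ i) := by
    intro m hm
    rw [← Fin.prod_univ_eq_prod_range
      (fun i => (Fintype.card K : ℚ) ^ m - (Fintype.card K : ℚ) ^ i), Nat.cast_prod]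
    refine Finset.prod_congr rfl fun i _ => ?_
    rw [Nat.cast_sub (Nat.pow_le_pow_right Fintype.card_pos (i.2.le.trans hm))]
    push_cast
    rfl
  have key := congrArg (Nat.cast : ℕ → ℚ) (card_subspaces_mul (K := K) (W := W) hk)
  rw [Nat.cast_mul, cast_prod _ le_rfl, cast_prod _ hk, prod_pow_sub_pow _ le_rfl,
    prod_pow_sub_pow _ hk, mul_left_comm] at key
  have h0 : ∏ i ∈ Finset.range k, (Fintype.card K : ℚ) ^ i ≠ 0 :=
    Finset.prod_ne_zero_iff.2 fun i _ => pow_ne_zero _ (by positivity)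
  have hrefl : ∏ i ∈ Finset.range k, ((Fintype.card K : ℚ) ^ (k - i) - 1) =
      ∏ i ∈ Finset.range k, ((Fintype.card K : ℚ) ^ (i + 1) - 1) := by
    rw [← Finset.prod_range_reflect]
    refine Finset.prod_congr rfl fun i hi => ?_
    have := Finset.mem_range.1 hi
    congr 2
    omega
  rw [gaussBinom, Finset.prod_div_distrib, eq_div_iff, ← hrefl]
  · exact mul_left_cancel₀ h0 key
  · exact Finset.prod_ne_zero_iff.2 fun i _ =>
      (sub_pos.2 (one_lt_pow₀ hq (Nat.succ_ne_zero i))).ne'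

end Counting

section Rigidity

variable {K W : Type*} [Field K] [AddCommGroup W] [Module K W] [Fintype W]

open Classical in
theorem card_mul_sum_eq_sum_mul_sum_add (D : Submodule K W) (u G : W → ℝ)
    (hG : ∀ v, ∀ d ∈ D, G (v + d) = G v) :
    (Fintype.card D : ℝ) * ∑ v, u v * G v = ∑ v, G v * ∑ d : D, u (v + d) := by
  simp_rw [Finset.mul_sum]
  rw [Finset.sum_comm, ← Finset.mul_sum, ← nsmul_eq_mul, ← Finset.card_univ, ← Finset.sum_const]
  refine Finset.sum_congr rfl fun d _ => ?_
  rw [← Equiv.sum_comp (Equiv.addRight (d : W))]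
  refine Finset.sum_congr rfl fun v _ => ?_
  rw [Equiv.coe_addRight, hG v d d.2, mul_comm]

open Classical in
theorem sum_indicator_sub_mem (D : Submodule K W) (v₀ : W) :
    ∑ v, (if v - v₀ ∈ D then (1 : ℝ) else 0) = Fintype.card D := by
  rw [← Equiv.sum_comp (Equiv.addRight v₀)]
  simp [Fintype.card_subtype]

open Classical in
/-- If the sums of `u` over the cosets of `D` are `0` or `1`, with total `1`, then exactly one
coset carries the sum `1`. -/
theorem exists_coset_of_sum_eq_one (D : Submodule K W) (u : W → ℝ) (hu : ∑ v, u v = 1)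
    (h01 : ∀ v, ∑ d : D, u (v + d) = 0 ∨ ∑ d : D, u (v + d) = 1) :
    ∃ v₀, (∀ v, ∑ d : D, u (v + d) = 1 ↔ v - v₀ ∈ D) ∧
      ∀ G : W → ℝ, (∀ v, ∀ d ∈ D, G (v + d) = G v) → ∑ v, u v * G v = G v₀ := by
  have hcard : (0 : ℝ) < Fintype.card D := by exact_mod_cast Fintype.card_pos
  have htot : ∑ v, ∑ d : D, u (v + d) = Fintype.card D := by
    have := card_mul_sum_eq_sum_mul_sum_add D u (fun _ => 1) (fun _ _ _ => rfl)
    simpa [hu] using this.symm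
  obtain ⟨v₀, -, hv₀⟩ := Finset.exists_ne_zero_of_sum_ne_zero (htot.trans_ne hcard.ne')
  replace hv₀ := (h01 v₀).resolve_left hv₀
  have hinv : ∀ v, v - v₀ ∈ D → ∑ d : D, u (v + d) = 1 := by
    intro v hv
    rw [← hv₀, ← Equiv.sum_comp (Equiv.addLeft (⟨v - v₀, hv⟩ : D)) (fun d : D => u (v₀ + d))]
    refine Finset.sum_congr rfl fun d _ => congrArg u ?_
    simp only [Equiv.coe_addLeft, Submodule.coe_add]
    abel
  have hnonneg : ∀ v ∈ Finset.univ,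
      0 ≤ ∑ d : D, u (v + d) - if v - v₀ ∈ D then (1 : ℝ) else 0 := by
    intro v _
    split_ifs with hv
    · rw [hinv v hv, sub_self]
    · rcases h01 v with h | h <;> simp [h]
  have hfib : ∀ v, ∑ d : D, u (v + d) = if v - v₀ ∈ D then (1 : ℝ) else 0 := fun v =>
    sub_eq_zero.1 ((Finset.sum_eq_zero_iff_of_nonneg hnonneg).1
      (by rw [Finset.sum_sub_distrib, htot, sum_indicator_sub_mem, sub_self]) v (Finset.mem_univ v))
  refine ⟨v₀, fun v => by simp [hfib], fun G hG => mul_left_cancel₀ hcard.ne' ?_⟩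
  rw [card_mul_sum_eq_sum_mul_sum_add D u G hG, ← sum_indicator_sub_mem D v₀, Finset.sum_mul]
  refine Finset.sum_congr rfl fun v _ => ?_
  rw [hfib]
  split_ifs with hv
  · rw [mul_one, one_mul, ← hG v₀ _ hv, add_sub_cancel]
  · simp

theorem exists_finrank_eq_le_ker_inf_ker {k : ℕ} (hk : k + 2 ≤ finrank K W) (f g : Dual K W) :
    ∃ D : Submodule K W, finrank K D = k ∧ D ≤ LinearMap.ker f ∧ D ≤ LinearMap.ker g := by
  have hker := (f.prod g).finrank_range_add_finrank_ker
  have hrange : finrank K (LinearMap.range (f.prod g)) ≤ 2 := by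
    simpa using Submodule.finrank_le (LinearMap.range (f.prod g))
  obtain ⟨D, hD, hDk⟩ := exists_le_finrank_eq (K := K)
    (show k ≤ finrank K (LinearMap.ker (f.prod g)) by omega)
  rw [LinearMap.ker_prod] at hD
  exact ⟨D, hDk, hD.trans inf_le_left, hD.trans inf_le_right⟩

open Classical in
/-- A weight of total `1` whose sums over all `k`-dimensional affine subspaces are `0` or `1` has
sum `1` precisely on those through some fixed point. -/
theorem exists_point_of_sum_cosets {k : ℕ} (hk : k + 2 ≤ finrank K W) (u : W → ℝ)
    (hu : ∑ v, u v = 1)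
    (h01 : ∀ D : Submodule K W, finrank K D = k → ∀ v,
      ∑ d : D, u (v + d) = 0 ∨ ∑ d : D, u (v + d) = 1) :
    ∃ a, ∀ D : Submodule K W, finrank K D = k → ∀ v, ∑ d : D, u (v + d) = 1 ↔ v - a ∈ D := by
  have hcoset D hD := exists_coset_of_sum_eq_one D u hu (h01 D hD)
  have hdelta : ∀ (D : Submodule K W) (v₀ : W),
      (∀ G : W → ℝ, (∀ v, ∀ d ∈ D, G (v + d) = G v) → ∑ v, u v * G v = G v₀) →
      ∀ f : Dual K W, D ≤ LinearMap.ker f → ∀ b,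
        ∑ v, u v * (if f v = b then 1 else 0) = if f v₀ = b then (1 : ℝ) else 0 := by
    intro D v₀ h f hf b
    refine h (fun v => if f v = b then 1 else 0) fun v d hd => ?_
    simp only [map_add, LinearMap.mem_ker.1 (hf hd), add_zero]
  have hex : ∀ f : Dual K W, ∃ c, ∀ b,
      ∑ v, u v * (if f v = b then 1 else 0) = if c = b then (1 : ℝ) else 0 := by
    intro f
    obtain ⟨D, hD, hf, -⟩ := exists_finrank_eq_le_ker_inf_ker hk f f
    obtain ⟨v₀, -, h⟩ := hcoset D hD
    exact ⟨f v₀, hdelta D v₀ h f hf⟩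
  choose φ hφ using hex
  have hφ_eq : ∀ (D : Submodule K W) (v₀ : W),
      (∀ G : W → ℝ, (∀ v, ∀ d ∈ D, G (v + d) = G v) → ∑ v, u v * G v = G v₀) →
      ∀ f : Dual K W, D ≤ LinearMap.ker f → φ f = f v₀ := by
    intro D v₀ h f hf
    have := (hφ f (f v₀)).symm.trans (hdelta D v₀ h f hf (f v₀))
    by_contra hne
    simp [hne] at this
  let Φ : Dual K (Dual K W) :=
    { toFun := φ
      map_add' := fun f g => by
        obtain ⟨D, hD, hf, hg⟩ := exists_finrank_eq_le_ker_inf_ker hk f g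
        obtain ⟨v₀, -, h⟩ := hcoset D hD
        rw [hφ_eq D v₀ h f hf, hφ_eq D v₀ h g hg, hφ_eq D v₀ h (f + g) fun d hd => by
          simp [LinearMap.mem_ker.1 (hf hd), LinearMap.mem_ker.1 (hg hd)]]
        rfl
      map_smul' := fun c f => by
        obtain ⟨D, hD, hf, -⟩ := exists_finrank_eq_le_ker_inf_ker hk f f
        obtain ⟨v₀, -, h⟩ := hcoset D hD
        rw [hφ_eq D v₀ h f hf, hφ_eq D v₀ h (c • f) fun d hd => by
          simp [LinearMap.mem_ker.1 (hf hd)]]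
        rfl }
  obtain ⟨a, ha⟩ := (evalEquiv K W).surjective Φ
  have hfa : ∀ f : Dual K W, φ f = f a := fun f => (DFunLike.congr_fun ha f).symm
  refine ⟨a, fun D hD v => ?_⟩
  obtain ⟨v₀, hv₀, h⟩ := hcoset D hD
  have hmem : v₀ - a ∈ D := by
    by_contra hne
    obtain ⟨f, hf, hDf⟩ := Submodule.exists_le_ker_of_notMem hne
    exact hf (by rw [map_sub, ← hφ_eq D v₀ h f hDf, hfa, sub_self])
  rw [hv₀, ← Submodule.add_mem_iff_left D hmem, sub_add_sub_cancel]

end Rigidity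

section AffineSpan

variable {K V : Type*} [Field K] [AddCommGroup V] [Module K V] {h : Dual K V} {e : V}

/-- The subspace spanned by a direction `D ≤ ker h` at infinity and the point `e + v`. -/
def affineSpanAt (e : V) (D : Submodule K (LinearMap.ker h)) (v : LinearMap.ker h) :
    Submodule K V :=
  D.map (LinearMap.ker h).subtype ⊔ Submodule.span K {e + v}

theorem mem_affineSpanAt (he : h e = 1) {D : Submodule K (LinearMap.ker h)}
    {v : LinearMap.ker h} {x : V} :
    x ∈ affineSpanAt e D v ↔ ∃ d ∈ D, x = h x • (e + v) + d := by
  rw [affineSpanAt, Submodule.mem_sup]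
  constructor
  · rintro ⟨_, ⟨d, hd, rfl⟩, _, hy, rfl⟩
    obtain ⟨c, rfl⟩ := Submodule.mem_span_singleton.1 hy
    exact ⟨d, hd, by simp [he, add_comm]⟩
  · rintro ⟨d, hd, hx⟩
    exact ⟨d, ⟨d, hd, rfl⟩, _, Submodule.smul_mem _ _ (Submodule.mem_span_singleton_self _),
      by rw [add_comm, ← hx]⟩

theorem add_mem_affineSpanAt (he : h e = 1) {D : Submodule K (LinearMap.ker h)}
    {v y : LinearMap.ker h} : e + y ∈ affineSpanAt e D v ↔ y - v ∈ D := by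
  have hy : h (e + y) = 1 := by simp [he]
  rw [mem_affineSpanAt he, hy]
  constructor
  · rintro ⟨d, hd, hx⟩
    rw [one_smul, add_assoc, add_right_inj] at hx
    rwa [show y = v + d from Subtype.ext hx, add_sub_cancel_left]
  · intro hd
    exact ⟨_, hd, by rw [one_smul, Submodule.coe_sub]; abel⟩

theorem comap_affineSpanAt (he : h e = 1) (D : Submodule K (LinearMap.ker h))
    (v : LinearMap.ker h) : (affineSpanAt e D v).comap (LinearMap.ker h).subtype = D := by
  ext y
  rw [Submodule.mem_comap, mem_affineSpanAt he, Submodule.subtype_apply, LinearMap.mem_ker.1 y.2]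
  constructor
  · rintro ⟨d, hd, hx⟩
    rw [zero_smul, zero_add] at hx
    rwa [Subtype.ext hx]
  · exact fun hy => ⟨y, hy, by simp⟩

theorem affineSpanAt_not_le (he : h e = 1) (D : Submodule K (LinearMap.ker h))
    (v : LinearMap.ker h) : ¬ affineSpanAt e D v ≤ LinearMap.ker h := by
  intro hle
  have := LinearMap.mem_ker.1 (hle ((add_mem_affineSpanAt he (y := v)).2 (by simp)))
  simp [he] at this

theorem finrank_affineSpanAt [FiniteDimensional K V] (he : h e = 1)
    (D : Submodule K (LinearMap.ker h)) (v : LinearMap.ker h) :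
    finrank K (affineSpanAt e D v) = finrank K D + 1 := by
  rw [affineSpanAt, Submodule.finrank_sup_span_singleton, Submodule.finrank_map_subtype_eq]
  intro hmem
  have := LinearMap.mem_ker.1 (Submodule.map_subtype_le _ _ hmem)
  simp [he] at this

theorem affineSpanAt_comap (he : h e = 1) {S : Submodule K V} {v : LinearMap.ker h}
    (hv : e + v ∈ S) : affineSpanAt e (S.comap (LinearMap.ker h).subtype) v = S := by
  ext x
  rw [mem_affineSpanAt he]
  constructor
  · rintro ⟨d, hd, hx⟩
    exact hx ▸ S.add_mem (S.smul_mem _ hv) hd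
  · intro hx
    refine ⟨⟨x - h x • (e + v), by simp [he]⟩, S.sub_mem hx (S.smul_mem _ hv), by simp⟩

theorem exists_add_mem_of_not_le (he : h e = 1) {S : Submodule K V}
    (hS : ¬ S ≤ LinearMap.ker h) : ∃ v : LinearMap.ker h, e + v ∈ S := by
  obtain ⟨x, hx, hxh⟩ := SetLike.not_le_iff_exists.1 hS
  have hx0 : h x ≠ 0 := hxh
  refine ⟨⟨(h x)⁻¹ • x - e, by simp [he, hx0]⟩, ?_⟩
  simpa using S.smul_mem _ hx

theorem span_singleton_add_injective (he : h e = 1) :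
    Function.Injective fun v : LinearMap.ker h => Submodule.span K {e + (v : V)} := by
  intro v y (hvy : Submodule.span K {e + (v : V)} = Submodule.span K {e + (y : V)})
  obtain ⟨c, hc⟩ := Submodule.mem_span_singleton.1
    (hvy ▸ Submodule.mem_span_singleton_self (e + (v : V)))
  have hc1 : c = 1 := by simpa [he] using congrArg h hc
  rw [hc1, one_smul, add_right_inj] at hc
  exact (Subtype.ext hc).symm

end AffineSpan

section AffineSubspaces

variable {K : Type} [Field K] {n k : ℕ} {h : Dual K (Fin (n + 1) → K)} {e : Fin (n + 1) → K}

theorem isAffSub_affineSpanAt (he : h e = 1) {D : Submodule K (LinearMap.ker h)}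
    (hD : finrank K D = k) (v : LinearMap.ker h) :
    IsAffSub k (LinearMap.ker h) (affineSpanAt e D v) :=
  ⟨by rw [finrank_affineSpanAt he, hD], affineSpanAt_not_le he D v⟩

theorem IsAffSub.finrank_comap (he : h e = 1) {S : Submodule K (Fin (n + 1) → K)}
    (hS : IsAffSub k (LinearMap.ker h) S) :
    finrank K (S.comap (LinearMap.ker h).subtype) = k := by
  obtain ⟨v, hv⟩ := exists_add_mem_of_not_le he hS.2
  have := finrank_affineSpanAt he (S.comap (LinearMap.ker h).subtype) v
  rw [affineSpanAt_comap he hv, hS.1] at this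
  omega

theorem isAffPoint_span (he : h e = 1) (v : LinearMap.ker h) :
    IsAffPoint (LinearMap.ker h) (Submodule.span K {e + (v : Fin (n + 1) → K)}) := by
  have hv : h (e + v) = 1 := by simp [he]
  refine ⟨finrank_span_singleton fun h0 => by simp [h0] at hv, fun hle => ?_⟩
  have := LinearMap.mem_ker.1 (hle (Submodule.mem_span_singleton_self _))
  simp [he] at this

theorem setOf_isAffPoint_le_affineSpanAt (he : h e = 1) (D : Submodule K (LinearMap.ker h))
    (v : LinearMap.ker h) :
    {P | IsAffPoint (LinearMap.ker h) P ∧ P ≤ affineSpanAt e D v} =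
      Set.range fun d : D =>
        Submodule.span K {e + ((v + d : LinearMap.ker h) : Fin (n + 1) → K)} := by
  ext P
  constructor
  · rintro ⟨hP, hle⟩
    obtain ⟨y, hy⟩ := exists_add_mem_of_not_le he hP.2
    refine ⟨⟨y - v, (add_mem_affineSpanAt he).1 (hle hy)⟩, ?_⟩
    simp only [add_sub_cancel]
    exact Submodule.eq_of_le_of_finrank_eq ((Submodule.span_singleton_le_iff_mem _ _).2 hy)
      ((isAffPoint_span he y).1.trans hP.1.symm)
  · rintro ⟨d, rfl⟩
    refine ⟨isAffPoint_span he _, (Submodule.span_singleton_le_iff_mem _ _).2 ?_⟩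
    exact (add_mem_affineSpanAt he).2 (by simp)

end AffineSubspaces

section Incidence

variable {h : Dual F (Fin (n + 1) → F)} {e : Fin (n + 1) → F} {k : ℕ}

open Classical in
theorem finsum_isAffPoint_le_affineSpanAt (he : h e = 1) (D : Submodule F (LinearMap.ker h))
    (v : LinearMap.ker h) (w : Submodule F (Fin (n + 1) → F) → ℝ) :
    ∑ᶠ P ∈ {P | IsAffPoint (LinearMap.ker h) P ∧ P ≤ affineSpanAt e D v}, w P =
      ∑ d : D, w (Submodule.span F {e + ((v + d : LinearMap.ker h) : Fin (n + 1) → F)}) := by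
  rw [setOf_isAffPoint_le_affineSpanAt he, finsum_mem_range, finsum_eq_sum_of_fintype]
  intro d d' hd
  exact Subtype.ext (add_left_cancel (span_singleton_add_injective he hd))

open Classical in
theorem card_filter_add_mem (he : h e = 1) {S : Submodule F (Fin (n + 1) → F)}
    (hS : IsAffSub k (LinearMap.ker h) S) :
    (Finset.univ.filter fun v : LinearMap.ker h => e + (v : Fin (n + 1) → F) ∈ S).card =
      Fintype.card F ^ k := by
  obtain ⟨v₀, hv₀⟩ := exists_add_mem_of_not_le he hS.2
  have hmem : ∀ v : LinearMap.ker h, e + (v : Fin (n + 1) → F) ∈ S ↔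
      v - v₀ ∈ S.comap (LinearMap.ker h).subtype := by
    intro v
    rw [← add_mem_affineSpanAt he, affineSpanAt_comap he hv₀]
  have hsum := sum_indicator_sub_mem (S.comap (LinearMap.ker h).subtype) v₀
  rw [Finset.sum_boole] at hsum
  simp only [hmem]
  rw [Nat.cast_injective hsum, Module.card_eq_pow_finrank (K := F), hS.finrank_comap he]

open Classical in
/-- Double counting of the pairs of a `k`-space in `L` and an affine point on it. -/
theorem sum_indicator_affineSpanAt (he : h e = 1) {L : Set (Submodule F (Fin (n + 1) → F))}
    (hL : ∀ S ∈ L, IsAffSub k (LinearMap.ker h) S) :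
    ∑ D : {D : Submodule F (LinearMap.ker h) // finrank F D = k}, ∑ v : LinearMap.ker h,
        L.indicator (fun _ => (1 : ℝ)) (affineSpanAt e D.1 v) =
      L.ncard * (Fintype.card F : ℝ) ^ k := by
  have hpoint : ∀ v : LinearMap.ker h,
      ∑ D : {D : Submodule F (LinearMap.ker h) // finrank F D = k},
        L.indicator (fun _ => (1 : ℝ)) (affineSpanAt e D.1 v) =
      ∑ S : L, if e + (v : Fin (n + 1) → F) ∈ S.1 then (1 : ℝ) else 0 := by
    intro v
    simp only [Set.indicator_apply, Finset.sum_boole, Nat.cast_inj]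
    refine Finset.card_bij' (fun D hD => ⟨affineSpanAt e D.1 v, (Finset.mem_filter.1 hD).2⟩)
      (fun S _ => ⟨S.1.comap (LinearMap.ker h).subtype, (hL S S.2).finrank_comap he⟩) ?_ ?_ ?_ ?_
    · intro D hD
      simp [add_mem_affineSpanAt he]
    · intro S hS
      have hv := (Finset.mem_filter.1 hS).2
      simp [affineSpanAt_comap he hv]
    · intro D hD
      exact Subtype.ext (comap_affineSpanAt he D.1 v)
    · intro S hS
      exact Subtype.ext (affineSpanAt_comap he (Finset.mem_filter.1 hS).2)
  rw [Finset.sum_comm]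
  simp only [hpoint]
  rw [Finset.sum_comm]
  simp only [Finset.sum_boole]
  rw [Finset.sum_congr rfl fun S _ => by rw [card_filter_add_mem he (hL S.1 S.2)], Finset.sum_const,
    Finset.card_univ, nsmul_eq_mul, ← Nat.card_eq_fintype_card, Nat.card_coe_set_eq]
  push_cast
  rfl

end Incidence

theorem exists_dual_ker_eq {K V : Type*} [Field K] [AddCommGroup V] [Module K V]
    [FiniteDimensional K V] {H : Submodule K V} (hH : finrank K H + 1 = finrank K V) :
    ∃ (h : Dual K V) (e : V), h e = 1 ∧ LinearMap.ker h = H := by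
  obtain ⟨x, -, hx⟩ := SetLike.exists_of_lt
    (lt_top_iff_ne_top.2 fun htop : H = ⊤ => by rw [htop, finrank_top] at hH; omega)
  obtain ⟨h, hx0, hle⟩ := Submodule.exists_le_ker_of_notMem hx
  refine ⟨h, (h x)⁻¹ • x, by simp [hx0], (Submodule.eq_of_le_of_finrank_eq hle ?_).symm⟩
  have := Dual.finrank_ker_add_one_of_ne_zero (f := h) (fun h0 => hx0 (by simp [h0]))
  omega

theorem statement11 (q k : ℕ) (hq : IsPrimePow q) (hF : Fintype.card F = q)
    (hk : 1 ≤ k) (hn : 2 * k + 1 ≤ n)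
    (Hinf : Submodule F (Fin (n + 1) → F)) (hH : Module.finrank F Hinf = n)
    (L : Set (Submodule F (Fin (n + 1) → F)))
    (hL : IsCLAff k Hinf L)
    (hcard : (L.ncard : ℚ) = gaussBinom q n k) :
    ∃ P, IsAffPoint Hinf P ∧ L = {K | IsAffSub k Hinf K ∧ P ≤ K} := by
  classical
  obtain ⟨h, e, he, rfl⟩ := exists_dual_ker_eq (H := Hinf) (by simp [hH])
  obtain ⟨hLsub, w, hw⟩ := hL
  let u : LinearMap.ker h → ℝ := fun v => w (Submodule.span F {e + (v : Fin (n + 1) → F)})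
  have hu : ∀ D : Submodule F (LinearMap.ker h), finrank F D = k → ∀ v,
      ∑ d : D, u (v + d) = L.indicator (fun _ => (1 : ℝ)) (affineSpanAt e D v) := by
    intro D hD v
    rw [hw _ (isAffSub_affineSpanAt he hD v), finsum_isAffPoint_le_affineSpanAt he]
  have hdir : Nat.card {D : Submodule F (LinearMap.ker h) // finrank F D = k} = L.ncard := by
    have := card_subspaces_eq_gaussBinom (K := F) (W := LinearMap.ker h) (k := k) (by omega)
    rw [hH, hF, ← hcard] at this
    exact_mod_cast this
  have hdir_pos : (L.ncard : ℝ) ≠ 0 := by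
    obtain ⟨D, -, hD⟩ := exists_le_finrank_eq (K := F)
      (E := (⊤ : Submodule F (LinearMap.ker h))) (k := k) (by rw [finrank_top]; omega)
    have : Nonempty {D : Submodule F (LinearMap.ker h) // finrank F D = k} := ⟨⟨D, hD⟩⟩
    rw [← hdir]
    exact_mod_cast Nat.card_pos.ne'
  have hsum : ∑ v, u v = 1 := by
    have hq0 : (Fintype.card F : ℝ) ^ k ≠ 0 := by positivity
    have hD : ∀ D : {D : Submodule F (LinearMap.ker h) // finrank F D = k},
        ∑ v, L.indicator (fun _ => (1 : ℝ)) (affineSpanAt e D.1 v) =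
          (Fintype.card F : ℝ) ^ k * ∑ v, u v := by
      intro D
      have := card_mul_sum_eq_sum_mul_sum_add D.1 u (fun _ => 1) (fun _ _ _ => rfl)
      rw [Module.card_eq_pow_finrank (K := F), D.2] at this
      simpa [hu D.1 D.2] using this.symm
    have hcount := sum_indicator_affineSpanAt he hLsub
    rw [Finset.sum_congr rfl fun D _ => hD D, Finset.sum_const, Finset.card_univ,
      ← Nat.card_eq_fintype_card, hdir, nsmul_eq_mul] at hcount
    have := mul_left_cancel₀ hdir_pos hcount
    exact mul_left_cancel₀ hq0 (this.trans (mul_one _).symm)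
  obtain ⟨a, ha⟩ := exists_point_of_sum_cosets (K := F) (k := k) (by omega) u hsum
    fun D hD v => by
      rw [hu D hD, Set.indicator_apply]
      split_ifs <;> simp
  refine ⟨_, isAffPoint_span he a, Set.ext fun S => ?_⟩
  have key : IsAffSub k (LinearMap.ker h) S →
      (S ∈ L ↔ Submodule.span F {e + (a : Fin (n + 1) → F)} ≤ S) := by
    intro hS
    obtain ⟨v, hv⟩ := exists_add_mem_of_not_le he hS.2
    have hmem := ha _ (hS.finrank_comap he) v
    rw [hu _ (hS.finrank_comap he), affineSpanAt_comap he hv, ← neg_mem_iff, neg_sub,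
      ← add_mem_affineSpanAt he, affineSpanAt_comap he hv] at hmem
    rw [Submodule.span_singleton_le_iff_mem, ← hmem, Set.indicator_apply]
    simp
  exact ⟨fun hS => ⟨hLsub S hS, (key (hLsub S hS)).1 hS⟩, fun hS => (key hS.1).2 hS.2⟩
end

section
/- Let q be a prime power, F a finite field with q elements, 0 ≤ i ≤ k−2 and n ≥ 2k−i. Let 𝓛 be a Cameron–Liebler k-set of AG(n,q) with |𝓛| = x·[n k]_q. Let I ≤ H∞ be a submodule with finrank I = i+1, and let π be a submodule of V with finrank π = n−i and I ⊓ π = ⊥ (so π is skew to I and V = I ⊕ π). Regard π as the ambient space of a PG(n−i−1,q) with hyperplane at infinity H∞′ := π ⊓ H∞: its projective j-spaces are the submodules of π of finrank j+1, its affine points and affine j-spaces are those not contained in H∞′, and a set 𝓙 of its affine (k−i−1)-spaces is a Cameron–Liebler (k−i−1)-set of this AG(n−i−1,q) if there exists w : {its affine points} → ℝ with (1 if J ∈ 𝓙 else 0) = ∑_{its affine points P ≤ J} w(P) for every affine (k−i−1)-space J of π. Then 𝓙 := {K ⊓ π : K ∈ 𝓛 and I ≤ K} is a Cameron–Liebler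 (k−i−1)-set of this AG(n−i−1,q) with |𝓙| = x·[n−i−1 k−i−1]_q (the same parameter x). -/
open Module

variable {F : Type} [Field F] [Fintype F] {n : ℕ}

/-- A tuple of `k` independent vectors is the same as a subspace of rank `k` with such a tuple
inside it. -/
theorem card_submodule_finrank_mul {K M : Type*} [Field K] [Fintype K] [AddCommGroup M]
    [Module K M] [Finite M] {k : ℕ} (hk : k ≤ finrank K M) :
    Nat.card {W : Submodule K M // finrank K W = k} *
        ∏ i : Fin k, (Fintype.card K ^ k - Fintype.card K ^ (i : ℕ)) =
      ∏ i : Fin k, (Fintype.card K ^ finrank K M - Fintype.card K ^ (i : ℕ)) := by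
  classical
  have := Fintype.ofFinite {W : Submodule K M // finrank K W = k}
  rw [← card_linearIndependent (K := K) (V := M) hk]
  let g : (Σ W : {W : Submodule K M // finrank K W = k},
      {t : Fin k → W.1 // LinearIndependent K t}) → {s : Fin k → M // LinearIndependent K s} :=
    fun p => ⟨fun j => (p.2.1 j : M), p.2.2.map' p.1.1.subtype p.1.1.ker_subtype⟩
  have hspan : ∀ p, Submodule.span K (Set.range (g p).1) = p.1.1 := by
    rintro ⟨⟨W, hW⟩, t, ht⟩
    apply Submodule.eq_of_le_of_finrank_eq
    · rw [Submodule.span_le]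
      rintro _ ⟨j, rfl⟩
      exact (t j).2
    · rw [finrank_span_eq_card (g ⟨⟨W, hW⟩, t, ht⟩).2, Fintype.card_fin, hW]
  have hg : Function.Bijective g := by
    constructor
    · intro p p' h
      have hW : p.1 = p'.1 := Subtype.ext (by rw [← hspan p, ← hspan p', h])
      obtain ⟨W, t, ht⟩ := p
      obtain ⟨W', t', ht'⟩ := p'
      obtain rfl : W = W' := hW
      obtain rfl : t = t' := by
        funext j
        exact Subtype.ext (congrFun (congrArg Subtype.val h) j)
      rfl
    · rintro ⟨s, hs⟩
      refine ⟨⟨⟨Submodule.span K (Set.range s), by rw [finrank_span_eq_card hs, Fintype.card_fin]⟩,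
        fun j => ⟨s j, Submodule.subset_span ⟨j, rfl⟩⟩, ?_⟩, rfl⟩
      exact LinearIndependent.of_comp (Submodule.subtype _) hs
  rw [← Nat.card_congr (Equiv.ofBijective g hg), Nat.card_sigma]
  have : ∀ W : {W : Submodule K M // finrank K W = k},
      Nat.card {t : Fin k → W.1 // LinearIndependent K t} =
        ∏ i : Fin k, (Fintype.card K ^ k - Fintype.card K ^ (i : ℕ)) := by
    rintro ⟨W, hW⟩
    rw [card_linearIndependent hW.ge, hW]
  simp [this]

theorem gaussBinom_mul {q a b : ℕ} (hq : 1 < q) (hb : b ≤ a) :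
    gaussBinom q a b * ∏ i : Fin b, ((q ^ b - q ^ (i : ℕ) : ℕ) : ℚ) =
      ∏ i : Fin b, ((q ^ a - q ^ (i : ℕ) : ℕ) : ℚ) := by
  have hq' : (1 : ℚ) < q := by exact_mod_cast hq
  have key : ∀ c, b ≤ c → ∏ i : Fin b, ((q ^ c - q ^ (i : ℕ) : ℕ) : ℚ) =
      (∏ i ∈ Finset.range b, (q : ℚ) ^ i) * ∏ i ∈ Finset.range b, ((q : ℚ) ^ (c - i) - 1) := by
    intro c hc
    rw [Fin.prod_univ_eq_prod_range (fun i => ((q ^ c - q ^ i : ℕ) : ℚ)) b,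
      ← Finset.prod_mul_distrib]
    refine Finset.prod_congr rfl fun i hi => ?_
    have hi' : i ≤ c := (Finset.mem_range.1 hi).le.trans hc
    rw [Nat.cast_sub (Nat.pow_le_pow_right hq.le hi'), mul_sub, ← pow_add,
      Nat.add_sub_cancel' hi']
    simp
  have hflip : ∏ i ∈ Finset.range b, ((q : ℚ) ^ (b - i) - 1) =
      ∏ i ∈ Finset.range b, ((q : ℚ) ^ (i + 1) - 1) := by
    rw [← Finset.prod_range_reflect]
    refine Finset.prod_congr rfl fun i hi => ?_
    have := Finset.mem_range.1 hi
    congr 2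
    omega
  have hne : ∏ i ∈ Finset.range b, ((q : ℚ) ^ (i + 1) - 1) ≠ 0 :=
    Finset.prod_ne_zero_iff.2 fun i _ => (sub_pos.2 (one_lt_pow₀ hq' i.succ_ne_zero)).ne'
  rw [key a hb, key b le_rfl, hflip, gaussBinom, Finset.prod_div_distrib]
  field_simp

theorem gaussBinom_pos {q a b : ℕ} (hq : 1 < q) (hb : b ≤ a) : 0 < gaussBinom q a b := by
  have hq' : (1 : ℚ) < q := by exact_mod_cast hq
  refine Finset.prod_pos fun i hi => div_pos ?_ ?_
  · exact sub_pos.2 (one_lt_pow₀ hq' (by have := Finset.mem_range.1 hi; omega))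
  · exact sub_pos.2 (one_lt_pow₀ hq' i.succ_ne_zero)

theorem card_submodule_finrank {K M : Type*} [Field K] [Fintype K] [AddCommGroup M]
    [Module K M] [Finite M] {k : ℕ} (hk : k ≤ finrank K M) :
    (Nat.card {W : Submodule K M // finrank K W = k} : ℚ) =
      gaussBinom (Fintype.card K) (finrank K M) k := by
  have hq : 1 < Fintype.card K := Fintype.one_lt_card
  have h := congrArg (Nat.cast : ℕ → ℚ) (card_submodule_finrank_mul hk)
  rw [Nat.cast_mul, Nat.cast_prod, Nat.cast_prod, ← gaussBinom_mul hq hk] at h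
  refine mul_right_cancel₀ (Finset.prod_ne_zero_iff.2 fun i _ => ?_) h
  rw [Nat.cast_ne_zero]
  exact (Nat.sub_pos_of_lt (Nat.pow_lt_pow_right hq i.2)).ne'

/-- The number of subspaces of rank `b + 1` through a point of a space of rank `a + 1`. -/
theorem card_submodule_through_point {K M : Type*} [Field K] [Fintype K] [AddCommGroup M]
    [Module K M] [Finite M] {P : Submodule K M} (hP : finrank K P = 1) {a b : ℕ}
    (ha : finrank K M = a + 1) (hb : b ≤ a) :
    (Nat.card {W : Submodule K M // P ≤ W ∧ finrank K W = b + 1} : ℚ) =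
      gaussBinom (Fintype.card K) a b := by
  have hquot : finrank K (M ⧸ P) = a := by
    have := P.finrank_quotient_add_finrank
    omega
  have : Finite (M ⧸ P) := .of_surjective P.mkQ P.mkQ_surjective
  rw [← hquot, ← card_submodule_finrank (hquot ▸ hb)]
  congr 1
  refine Nat.card_congr (Equiv.symm ?_)
  refine ((Submodule.comapMkQRelIso P).toEquiv.subtypeEquiv
    (q := fun W : Set.Ici P => finrank K (W : Submodule K M) = b + 1) fun W => ?_).trans
      (Equiv.subtypeSubtypeEquivSubtypeInter (fun W => P ≤ W) fun W => finrank K W = b + 1)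
  change finrank K W = b ↔ finrank K (W.comap P.mkQ) = b + 1
  have h1 := (Submodule.quotientQuotientEquivQuotient P _ (P.le_comap_mkQ W)).finrank_eq
  rw [Submodule.map_comap_eq_of_surjective P.mkQ_surjective] at h1
  have h2 := W.finrank_quotient_add_finrank
  have h3 := (W.comap P.mkQ).finrank_quotient_add_finrank
  omega

/-- The number of subspaces of rank `b + 1` between a point and a subspace of rank `a + 1`. -/
theorem card_submodule_between {K M : Type*} [Field K] [Fintype K] [AddCommGroup M]
    [Module K M] [Finite M] {P U : Submodule K M} (hP : finrank K P = 1) (hPU : P ≤ U) {a b : ℕ}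
    (ha : finrank K U = a + 1) (hb : b ≤ a) :
    (Nat.card {W : Submodule K M // W ≤ U ∧ P ≤ W ∧ finrank K W = b + 1} : ℚ) =
      gaussBinom (Fintype.card K) a b := by
  have hP' : finrank K (P.comap U.subtype) = 1 :=
    (Submodule.comapSubtypeEquivOfLe hPU).finrank_eq.trans hP
  rw [← card_submodule_through_point hP' ha hb]
  congr 1
  refine Nat.card_congr (Equiv.symm ?_)
  refine ((Submodule.mapIic U).toEquiv.subtypeEquiv
    (p := fun W => P.comap U.subtype ≤ W ∧ finrank K W = b + 1)
    (q := fun W : Set.Iic U => P ≤ (W : Submodule K M) ∧ finrank K (W : Submodule K M) = b + 1)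
    fun W => ?_).trans
      (Equiv.subtypeSubtypeEquivSubtypeInter (fun W => W ≤ U)
        fun W => P ≤ W ∧ finrank K W = b + 1)
  change _ ↔ P ≤ W.map U.subtype ∧ finrank K (W.map U.subtype) = b + 1
  rw [Submodule.finrank_map_subtype_eq]
  refine and_congr_left fun _ => ⟨fun h => ?_, fun h => ?_⟩
  · have := Submodule.map_mono (f := U.subtype) h
    rwa [Submodule.map_comap_subtype, inf_eq_right.2 hPU] at this
  · have := Submodule.comap_mono (f := U.subtype) h
    rwa [Submodule.comap_map_eq_of_injective U.injective_subtype] at this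

open Classical in
/-- The points of `U` that do not lie in `H`. -/
noncomputable def pointsOff {K M : Type*} [Field K] [AddCommGroup M] [Module K M]
    [Fintype (Submodule K M)] (H U : Submodule K M) : Finset (Submodule K M) :=
  {P | P ≤ U ∧ finrank K P = 1 ∧ ¬ P ≤ H}

theorem mem_pointsOff {K M : Type*} [Field K] [AddCommGroup M] [Module K M]
    [Fintype (Submodule K M)] {H U P : Submodule K M} :
    P ∈ pointsOff H U ↔ finrank K P = 1 ∧ ¬ P ≤ H ∧ P ≤ U := by
  simp only [pointsOff, Finset.mem_filter, Finset.mem_univ, true_and]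
  tauto

open Classical in
/-- Double counting of the incident pairs of an affine point and an affine subspace inside `U`. -/
theorem sum_sum_affine_points {K M : Type*} [Field K] [Fintype K] [AddCommGroup M]
    [Module K M] [Finite M] [Fintype (Submodule K M)] {U H : Submodule K M} {a b : ℕ}
    (ha : finrank K U = a + 1) (hb : b ≤ a) (w : Submodule K M → ℝ) :
    ∑ W : Submodule K M with W ≤ U ∧ finrank K W = b + 1 ∧ ¬ W ≤ H,
        ∑ P ∈ pointsOff H W, w P =
      (gaussBinom (Fintype.card K) a b : ℝ) *
        ∑ P ∈ pointsOff H U, w P := by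
  rw [Finset.sum_comm' (t' := pointsOff H U)
    (s' := fun P => {W : Submodule K M | W ≤ U ∧ P ≤ W ∧ finrank K W = b + 1}), Finset.mul_sum]
  · refine Finset.sum_congr rfl fun P hP => ?_
    simp only [mem_pointsOff] at hP
    rw [← card_submodule_between hP.1 hP.2.2 ha hb, Finset.sum_const, nsmul_eq_mul,
      Nat.card_eq_fintype_card, Fintype.card_subtype]
    norm_cast
  · intro W P
    simp only [Finset.mem_filter, Finset.mem_univ, true_and, mem_pointsOff]
    constructor
    · rintro ⟨⟨h1, h2, h3⟩, h4, h5, h6⟩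
      exact ⟨⟨h1, h6, h2⟩, h4, h5, h6.trans h1⟩
    · rintro ⟨⟨h1, h6, h2⟩, h4, h5, -⟩
      exact ⟨⟨h1, h2, fun h => h5 (h6.trans h)⟩, h4, h5, h6⟩

section Complement

variable {K M : Type*} [Field K] [AddCommGroup M] [Module K M] {I C : Submodule K M}

theorem IsCompl.sup_inf_of_le (h : IsCompl I C) {W : Submodule K M} (hW : I ≤ W) :
    I ⊔ W ⊓ C = W := by
  rw [inf_comm, ← sup_inf_assoc_of_le C hW, h.sup_eq_top, top_inf_eq]

theorem IsCompl.sup_inf_eq_of_le (h : IsCompl I C) {W : Submodule K M} (hW : W ≤ C) :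
    (I ⊔ W) ⊓ C = W := by
  rw [sup_comm, sup_inf_assoc_of_le I hW, h.inf_eq_bot, sup_bot_eq]

theorem IsCompl.finrank_inf_add [FiniteDimensional K M] (h : IsCompl I C) {W : Submodule K M}
    (hW : I ≤ W) : finrank K ↥(W ⊓ C) + finrank K I = finrank K W := by
  have h1 := Submodule.finrank_sup_add_finrank_inf_eq I (W ⊓ C)
  rw [h.sup_inf_of_le hW, (h.disjoint.mono_right inf_le_right).eq_bot, finrank_bot] at h1
  omega

theorem IsCompl.finrank_point_proj [FiniteDimensional K M] (h : IsCompl I C)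
    {P : Submodule K M} (hP : finrank K P = 1) (hPI : ¬ P ≤ I) :
    finrank K ↥((I ⊔ P) ⊓ C) = 1 := by
  have h1 := Submodule.finrank_sup_add_finrank_inf_eq I P
  have h2 := h.finrank_inf_add (le_sup_left : I ≤ I ⊔ P)
  have h3 : finrank K ↥(I ⊓ P) < finrank K P :=
    Submodule.finrank_lt_finrank_of_lt (inf_lt_right.2 hPI)
  omega

open Classical in
/-- The points off `H` in `I ⊔ W` are partitioned by their projections from `I` to `W`. -/
theorem IsCompl.sum_points_sup [FiniteDimensional K M] [Fintype (Submodule K M)]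
    (h : IsCompl I C) {H : Submodule K M} (hI : I ≤ H) (w : Submodule K M → ℝ)
    {W : Submodule K M} (hW : W ≤ C) :
    ∑ P ∈ pointsOff H (I ⊔ W), w P =
      ∑ Q ∈ pointsOff H W,
        ∑ P ∈ pointsOff H (I ⊔ Q), w P := by
  rw [← Finset.sum_fiberwise_of_maps_to
    (t := pointsOff H W)
    (g := fun P => (I ⊔ P) ⊓ C)]
  · refine Finset.sum_congr rfl fun Q hQ => Finset.sum_congr ?_ fun _ _ => rfl
    ext P
    simp only [Finset.mem_filter, mem_pointsOff] at hQ ⊢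
    constructor
    · rintro ⟨⟨h1, h2, -⟩, h4⟩
      refine ⟨h1, h2, ?_⟩
      rw [← h4, h.sup_inf_of_le le_sup_left]
      exact le_sup_right
    · rintro ⟨h1, h2, h3⟩
      refine ⟨⟨h1, h2, h3.trans (sup_le_sup_left hQ.2.2 I)⟩,
        Submodule.eq_of_le_of_finrank_eq ?_ ?_⟩
      · refine le_of_le_of_eq ?_ (h.sup_inf_eq_of_le (hQ.2.2.trans hW))
        exact inf_le_inf_right C (sup_le le_sup_left h3)
      · rw [h.finrank_point_proj h1 fun hP => h2 (hP.trans hI), hQ.1]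
  · intro P hP
    simp only [mem_pointsOff] at hP ⊢
    obtain ⟨h1, h2, h3⟩ := hP
    refine ⟨h.finrank_point_proj h1 fun hP => h2 (hP.trans hI), fun hQ => h2 ?_, ?_⟩
    · have := sup_le hI hQ
      rw [h.sup_inf_of_le le_sup_left] at this
      exact le_sup_right.trans this
    · calc (I ⊔ P) ⊓ C ≤ (I ⊔ W) ⊓ C := inf_le_inf_right C (sup_le le_sup_left h3)
        _ = W := h.sup_inf_eq_of_le hW

end Complement

open Classical in
theorem finsum_mem_setOf_eq_sum {α : Type*} [Fintype α] (p : α → Prop) (f : α → ℝ) :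
    ∑ᶠ a ∈ {a | p a}, f a = ∑ a with p a, f a := by
  rw [finsum_mem_eq_sum_of_inter_support_eq]
  simp

open Classical in
theorem ncard_eq_sum_indicator {α : Type*} [Fintype α] {S : Set α} {p : α → Prop}
    (h : ∀ a ∈ S, p a) :
    (S.ncard : ℝ) = ∑ a with p a, S.indicator (fun _ => (1 : ℝ)) a := by
  have : ({a | p a ∧ a ∈ S} : Finset α) = S.toFinset := by
    ext a
    simpa using h a
  simp [Set.indicator_apply, Finset.filter_filter, this,
    Set.ncard_eq_toFinset_card']

theorem statement15 (q k i x : ℕ) (hq : IsPrimePow q) (hF : Fintype.card F = q)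
    (hik : i + 2 ≤ k) (hn : 2 * k - i ≤ n)
    (Hinf : Submodule F (Fin (n + 1) → F)) (hH : Module.finrank F Hinf = n)
    (L : Set (Submodule F (Fin (n + 1) → F)))
    (hL : IsCLAff k Hinf L)
    (hcard : (L.ncard : ℚ) = (x : ℚ) * gaussBinom q n k)
    (I π : Submodule F (Fin (n + 1) → F))
    (hI : I ≤ Hinf) (hIr : Module.finrank F I = i + 1)
    (hπr : Module.finrank F π = n - i) (hskew : I ⊓ π = ⊥)
    (J : Set (Submodule F (Fin (n + 1) → F)))
    (hJ : J = {J' | ∃ K ∈ L, I ≤ K ∧ J' = K ⊓ π}) :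
    (∀ J' ∈ J, Module.finrank F J' = k - i ∧ J' ≤ π ∧ ¬ J' ≤ π ⊓ Hinf) ∧
    (∃ w : Submodule F (Fin (n + 1) → F) → ℝ,
      ∀ J' : Submodule F (Fin (n + 1) → F),
          Module.finrank F J' = k - i → J' ≤ π → ¬ J' ≤ π ⊓ Hinf →
        Set.indicator J (fun _ => (1 : ℝ)) J' =
          ∑ᶠ P ∈ {P : Submodule F (Fin (n + 1) → F) |
            Module.finrank F P = 1 ∧ P ≤ π ∧ ¬ P ≤ π ⊓ Hinf ∧ P ≤ J'}, w P) ∧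
    (J.ncard : ℚ) = (x : ℚ) * gaussBinom q (n - i - 1) (k - i - 1) := by
  classical
  have := Fintype.ofFinite (Submodule F (Fin (n + 1) → F))
  have hq1 : 1 < q := hq.one_lt
  have hcompl : IsCompl I π := by
    refine ⟨disjoint_iff.2 hskew, codisjoint_iff.2 (Submodule.eq_top_of_finrank_eq ?_)⟩
    have h1 := Submodule.finrank_sup_add_finrank_inf_eq I π
    rw [hskew, finrank_bot] at h1
    rw [Module.finrank_fin_fun]
    omega
  obtain ⟨hLaff, w, hw⟩ := hL
  have hmemJ : ∀ J' ≤ π, J' ∈ J ↔ I ⊔ J' ∈ L := by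
    intro J' hJ'
    rw [hJ]
    constructor
    · rintro ⟨K, hK, hIK, rfl⟩
      rwa [hcompl.sup_inf_of_le hIK]
    · exact fun h => ⟨_, h, le_sup_left, (hcompl.sup_inf_eq_of_le hJ').symm⟩
  have hJaff : ∀ J' ∈ J, finrank F J' = k - i ∧ J' ≤ π ∧ ¬ J' ≤ π ⊓ Hinf := by
    rw [hJ]
    rintro _ ⟨K, hK, hIK, rfl⟩
    have h1 := hcompl.finrank_inf_add hIK
    obtain ⟨h2, h3⟩ := hLaff K hK
    refine ⟨by omega, inf_le_right, fun h => h3 ?_⟩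
    rw [← hcompl.sup_inf_of_le hIK]
    exact sup_le hI (h.trans inf_le_right)
  let w' : Submodule F (Fin (n + 1) → F) → ℝ := fun Q =>
    ∑ P ∈ pointsOff Hinf (I ⊔ Q), w P
  have hsum : ∀ J' : Submodule F (Fin (n + 1) → F), finrank F J' = k - i → J' ≤ π →
      ¬ J' ≤ Hinf → J.indicator (fun _ => (1 : ℝ)) J' =
        ∑ P ∈ pointsOff Hinf J', w' P := by
    intro J' h1 h2 h3
    have hK : IsAffSub k Hinf (I ⊔ J') := by
      refine ⟨?_, fun h => h3 (le_sup_right.trans h)⟩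
      have := hcompl.finrank_inf_add (le_sup_left : I ≤ I ⊔ J')
      rw [hcompl.sup_inf_eq_of_le h2] at this
      omega
    have h4 := hw _ hK
    rw [finsum_mem_setOf_eq_sum] at h4
    rw [← hcompl.sum_points_sup hI w h2]
    simp only [Set.indicator_apply, hmemJ J' h2] at h4 ⊢
    rw [h4]
    exact Finset.sum_congr (by ext P; simp [mem_pointsOff, IsAffPoint, and_assoc]) fun _ _ => rfl
  refine ⟨hJaff, ⟨w', fun J' h1 h2 h3 => ?_⟩, ?_⟩
  · rw [hsum J' h1 h2 fun h => h3 (le_inf h2 h), finsum_mem_setOf_eq_sum]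
    refine Finset.sum_congr (Finset.ext fun P => ?_) fun _ _ => rfl
    simp only [mem_pointsOff, Finset.mem_filter, Finset.mem_univ, true_and]
    constructor
    · rintro ⟨h4, h5, h6⟩
      exact ⟨h4, h6.trans h2, fun h => h5 (h.trans inf_le_right), h6⟩
    · rintro ⟨h4, h5, h6, h7⟩
      exact ⟨h4, fun h => h6 (le_inf h5 h), h7⟩
  · have hLc : (L.ncard : ℝ) = (gaussBinom q n k : ℝ) *
        ∑ P ∈ pointsOff Hinf ⊤, w P := by
      rw [← hF, ← sum_sum_affine_points (U := ⊤) (by simp) (by omega),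
        ncard_eq_sum_indicator
          (p := fun K : Submodule F (Fin (n + 1) → F) => K ≤ ⊤ ∧ IsAffSub k Hinf K)
          fun K hK => ⟨le_top, hLaff K hK⟩]
      refine Finset.sum_congr (by ext; simp [IsAffSub]) fun K hK => ?_
      rw [hw K (Finset.mem_filter.1 hK).2.2, finsum_mem_setOf_eq_sum]
      exact Finset.sum_congr (by ext P; simp [mem_pointsOff, IsAffPoint, and_assoc]) fun _ _ => rfl
    have hJc : (J.ncard : ℝ) = (gaussBinom q (n - i - 1) (k - i - 1) : ℝ) *
        ∑ P ∈ pointsOff Hinf π, w' P := by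
      rw [← hF, ← sum_sum_affine_points (U := π) (by omega) (by omega),
        ncard_eq_sum_indicator (p := fun J' => J' ≤ π ∧ finrank F J' = k - i - 1 + 1 ∧ ¬ J' ≤ Hinf)]
      · refine Finset.sum_congr (by ext; simp) fun K hK => ?_
        obtain ⟨h1, h2, h3⟩ := (Finset.mem_filter.1 hK).2
        exact hsum K (by omega) h1 h3
      · intro J' hJ'
        obtain ⟨h1, h2, h3⟩ := hJaff J' hJ'
        exact ⟨h2, by omega, fun h => h3 (le_inf h2 h)⟩
    rw [← hcompl.sum_points_sup hI w le_rfl, hcompl.sup_eq_top] at hJc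
    have hpos : (gaussBinom q n k : ℝ) ≠ 0 := by
      exact_mod_cast (gaussBinom_pos hq1 (by omega : k ≤ n)).ne'
    have hx : (L.ncard : ℝ) = x * (gaussBinom q n k : ℝ) := by exact_mod_cast hcard
    have hW := mul_left_cancel₀ hpos ((hLc.symm.trans hx).trans (mul_comm _ _))
    rw [hW, mul_comm] at hJc
    exact_mod_cast hJc
end
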